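/- Let (A, J) be a flip pair over a finite set 𝒜. Then for every positive integer m, p_{2m-1, 0}(σ_A, φ_{J,A}) = Δ_Jᵀ A^{m-1} Δ_{AJ}, where Δ_M denotes the column vector of diagonal entries of a square matrix M. (Theorem 3.3, first formula.) -/

import Mathlib

open Matrix

/-- A zero-one integer matrix. -/
def IsZeroOne {α β : Type*} (M : Matrix α β ℤ) : Prop := ∀ a b, M a b = 0 ∨ M a b = 1

/-- A flip pair: a pair `(A, J)` of zero-one square matrices with `AJ = JAᵀ` and `J² = I`. -/
def IsFlipPair {α : Type*} [Fintype α] [DecidableEq α] (A J : Matrix α α ℤ) : Prop :=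
  IsZeroOne A ∧ IsZeroOne J ∧ A * J = J * Aᵀ ∧ J * J = 1

/-- The topological Markov chain `X_A` determined by `A`, as a subtype of `ℤ → α`
(which carries the product topology when `α` is a topological space). -/
abbrev SFT {α : Type*} (A : Matrix α α ℤ) :=
  {x : ℤ → α // ∀ i : ℤ, A (x i) (x (i + 1)) = 1}

/-- The shift map `σ_A` on `X_A`, as a bijection: `σ_A(x)_i = x_{i+1}`. -/
def shiftEquiv {α : Type*} (A : Matrix α α ℤ) : Equiv.Perm (SFT A) where
  toFun x := ⟨fun i => x.1 (i + 1), fun i => x.2 (i + 1)⟩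
  invFun x := ⟨fun i => x.1 (i - 1), fun i => by
    have h := x.2 (i - 1); rwa [show i - 1 + 1 = i + 1 - 1 by ring] at h⟩
  left_inv x := Subtype.ext (funext fun i => by
    show x.1 (i - 1 + 1) = x.1 i
    norm_num)
  right_inv x := Subtype.ext (funext fun i => by
    show x.1 (i + 1 - 1) = x.1 i
    norm_num)

/-- `pFix T m = p_m(T)`: the number of points fixed by `T^m`. -/
noncomputable def pFix {X : Type*} (T : Equiv.Perm X) (m : ℕ) : ℕ :=
  Nat.card {x : X // (T ^ m) x = x}

/-- `pFlip T φ m n = p_{m,n}(T, φ)`: the number of points fixed by both `T^m` and `T^n ∘ φ`. -/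
noncomputable def pFlip {X : Type*} (T : Equiv.Perm X) (φ : X → X) (m : ℕ) (n : ℤ) : ℕ :=
  Nat.card {x : X // (T ^ m) x = x ∧ (T ^ n) (φ x) = x}

/-- A bilinear form in a matrix power, as a weighted sum over paths. -/
theorem dotProduct_pow_mulVec_eq_sum_paths {α R : Type*} [Fintype α] [DecidableEq α]
    [CommSemiring R] (A : Matrix α α R) (g : α → R) (n : ℕ) (f : α → R) :
    f ⬝ᵥ (A ^ n).mulVec g = ∑ p : Fin (n + 1) → α,
      f (p 0) * (∏ i : Fin n, A (p i.castSucc) (p i.succ)) * g (p (Fin.last n)) := by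
  induction n generalizing f with
  | zero =>
    rw [← (Equiv.funUnique (Fin 1) α).symm.sum_comp]
    simp [dotProduct]
  | succ n ih =>
    rw [pow_succ', ← Matrix.mulVec_mulVec, Matrix.dotProduct_mulVec, ih,
      ← (Fin.consEquiv fun _ : Fin (n + 2) => α).sum_comp, Fintype.sum_prod_type_right]
    refine Finset.sum_congr rfl fun q _ => ?_
    simp only [Fin.consEquiv_apply, Matrix.vecMul, dotProduct, Finset.sum_mul]
    refine Finset.sum_congr rfl fun a _ => ?_
    rw [Fin.prod_univ_succ]
    simp only [Fin.castSucc_zero, Fin.cons_zero, Fin.cons_succ, Fin.castSucc_succ,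
      ← Fin.succ_last]
    ring

/-- If the weights are zero-one, a bilinear form in a matrix power counts paths. -/
theorem dotProduct_pow_mulVec_eq_card_paths {α : Type*} [Fintype α] [DecidableEq α]
    (A : Matrix α α ℤ) (f g : α → ℤ) (hA : IsZeroOne A)
    (hf : ∀ a, f a = 0 ∨ f a = 1) (hg : ∀ a, g a = 0 ∨ g a = 1) (n : ℕ) :
    f ⬝ᵥ (A ^ n).mulVec g = Nat.card {p : Fin (n + 1) → α //
      f (p 0) = 1 ∧ (∀ i : Fin n, A (p i.castSucc) (p i.succ) = 1) ∧ g (p (Fin.last n)) = 1} := by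
  classical
  rw [dotProduct_pow_mulVec_eq_sum_paths, Nat.card_eq_fintype_card, Fintype.card_subtype,
    Finset.card_filter, Nat.cast_sum]
  refine Finset.sum_congr rfl fun p _ => ?_
  split_ifs with h
  · simp [h.1, h.2.1, h.2.2]
  · by_cases h1 : f (p 0) = 1
    · by_cases h2 : ∀ i : Fin n, A (p i.castSucc) (p i.succ) = 1
      · have h3 : g (p (Fin.last n)) = 0 := (hg _).resolve_right fun h3 => h ⟨h1, h2, h3⟩
        simp [h3]
      · push Not at h2
        obtain ⟨i, hi⟩ := h2
        have h0 : ∏ i : Fin n, A (p i.castSucc) (p i.succ) = 0 :=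
          Finset.prod_eq_zero (Finset.mem_univ i) ((hA _ _).resolve_right hi)
        simp [h0]
    · simp [(hf _).resolve_right h1]

theorem shiftEquiv_pow_apply {α : Type*} (A : Matrix α α ℤ) (k : ℕ) (x : SFT A) (i : ℤ) :
    ((shiftEquiv A ^ k) x).1 i = x.1 (i + k) := by
  induction k generalizing x with
  | zero => simp
  | succ k ih =>
    rw [pow_succ, Equiv.Perm.mul_apply, ih]
    change x.1 (i + k + 1) = _
    push_cast
    rw [add_assoc]

theorem apply_emod_eq_of_periodic {α : Type*} {x : ℤ → α} {N : ℤ}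
    (h : Function.Periodic x N) (i : ℤ) : x (i % N) = x i := by
  rw [Int.emod_def, mul_comm]
  exact h.sub_int_mul_eq (i / N)

/-- The sequence of period `2 * n + 1` with values `p 0, …, p n, τ (p n), …, τ (p 1)` on
`0, …, 2 * n`. -/
def reflectExtend {α : Type*} (τ : α → α) (n : ℕ) (q : ℤ → α) (i : ℤ) : α :=
  if i % (2 * n + 1) ≤ n then q (i % (2 * n + 1)) else τ (q (2 * n + 1 - i % (2 * n + 1)))

theorem reflectExtend_periodic {α : Type*} (τ : α → α) (n : ℕ) (q : ℤ → α) :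
    Function.Periodic (reflectExtend τ n q) (2 * n + 1) := fun i => by
  simp [reflectExtend]

theorem reflectExtend_of_le {α : Type*} (τ : α → α) (n : ℕ) (q : ℤ → α) {i : ℤ}
    (h0 : 0 ≤ i) (hi : i ≤ n) : reflectExtend τ n q i = q i := by
  have h : i % (2 * n + 1) = i := Int.emod_eq_of_lt h0 (by omega)
  simp [reflectExtend, h, hi]

theorem reflectExtend_of_lt {α : Type*} (τ : α → α) (n : ℕ) (q : ℤ → α) {i : ℤ}
    (h0 : n < i) (hi : i ≤ 2 * n) : reflectExtend τ n q i = τ (q (2 * n + 1 - i)) := by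
  have h : i % (2 * n + 1) = i := Int.emod_eq_of_lt (by omega) (by omega)
  simp [reflectExtend, h, not_le.2 h0]

theorem reflectExtend_neg {α : Type*} {τ : α → α} (hτ : Function.Involutive τ) (n : ℕ)
    {q : ℤ → α} (hq : τ (q 0) = q 0) (i : ℤ) :
    τ (reflectExtend τ n q (-i)) = reflectExtend τ n q i := by
  have hper := reflectExtend_periodic τ n q
  have hneg : reflectExtend τ n q (-i) = reflectExtend τ n q (2 * n + 1 - i % (2 * n + 1)) := by
    rw [show (2 * n + 1 - i % (2 * n + 1) : ℤ) = -(i % (2 * n + 1)) + (2 * n + 1) by ring, hper,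
      ← apply_emod_eq_of_periodic hper, ← apply_emod_eq_of_periodic hper (-(i % _))]
    congr 1
    exact (Int.mod_modEq i _).neg.symm
  rw [hneg, ← apply_emod_eq_of_periodic hper i]
  have h0 := Int.emod_nonneg i (show (2 * n + 1 : ℤ) ≠ 0 by omega)
  have h1 := Int.emod_lt_of_pos i (show (0 : ℤ) < 2 * n + 1 by omega)
  generalize i % (2 * n + 1) = r at h0 h1
  rcases h0.eq_or_lt with rfl | h0
  · have h := hper 0
    rw [zero_add] at h
    rw [sub_zero, h, reflectExtend_of_le _ _ _ le_rfl (by omega), hq]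
  rcases le_or_gt r n with hr | hr
  · rw [reflectExtend_of_lt _ _ _ (by omega) (by omega), hτ,
      reflectExtend_of_le _ _ _ h0.le hr, sub_sub_cancel]
  · rw [reflectExtend_of_le _ _ _ (by omega) (by omega),
      reflectExtend_of_lt _ _ _ hr (by omega)]

theorem reflectExtend_mem_SFT {α : Type*} {A : Matrix α α ℤ} {τ : α → α} {n : ℕ} {q : ℤ → α}
    (hA : ∀ a b, A (τ b) (τ a) = A a b) (hq : τ (q 0) = q 0)
    (hstep : ∀ i : ℤ, 0 ≤ i → i < n → A (q i) (q (i + 1)) = 1) (hlast : A (q n) (τ (q n)) = 1)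
    (i : ℤ) : A (reflectExtend τ n q i) (reflectExtend τ n q (i + 1)) = 1 := by
  have hper := reflectExtend_periodic τ n q
  have hsucc : reflectExtend τ n q (i % (2 * n + 1) + 1) = reflectExtend τ n q (i + 1) :=
    apply_emod_eq_of_periodic (x := fun i => reflectExtend τ n q (i + 1))
      (fun i => by simp only [add_right_comm i, hper _]) i
  rw [← apply_emod_eq_of_periodic hper i, ← hsucc]
  have h0 := Int.emod_nonneg i (show (2 * n + 1 : ℤ) ≠ 0 by omega)
  have h1 := Int.emod_lt_of_pos i (show (0 : ℤ) < 2 * n + 1 by omega)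
  generalize i % (2 * n + 1) = r at h0 h1
  have hend : reflectExtend τ n q (2 * n + 1) = τ (q 0) := by
    have h := hper 0
    rw [zero_add] at h
    rw [h, reflectExtend_of_le _ _ _ le_rfl (by omega), hq]
  rcases lt_trichotomy r n with hr | rfl | hr
  · rw [reflectExtend_of_le _ _ _ h0 hr.le, reflectExtend_of_le _ _ _ (by omega) (by omega)]
    exact hstep r h0 hr
  · rw [reflectExtend_of_le _ _ _ h0 le_rfl]
    rcases Nat.eq_zero_or_pos n with rfl | hn
    · simp only [Nat.cast_zero, mul_zero, zero_add] at hend hlast ⊢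
      rwa [hend]
    · rw [reflectExtend_of_lt _ _ _ (by omega) (by omega),
        show (2 * n + 1 - (n + 1) : ℤ) = n by ring]
      exact hlast
  · have hr2 : reflectExtend τ n q (r + 1) = τ (q (2 * n - r)) := by
      rcases (show r ≤ 2 * n by omega).eq_or_lt with rfl | hlt
      · rw [hend, sub_self]
      · rw [reflectExtend_of_lt _ _ _ (by omega) (by omega)]
        congr 2
        ring
    rw [hr2, reflectExtend_of_lt _ _ _ hr (by omega), hA,
      show (2 * n + 1 - r : ℤ) = 2 * n - r + 1 by ring]
    exact hstep _ (by omega) (by omega)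

/-- A periodic, `τ`-reflection-symmetric sequence is determined by its values on `0, …, n`. -/
theorem eq_reflectExtend {α : Type*} {τ : α → α} {n : ℕ} {x : ℤ → α}
    (hx : Function.Periodic x (2 * n + 1)) (hflip : ∀ i, τ (x (-i)) = x i) {q : ℤ → α}
    (hq : ∀ i : ℤ, 0 ≤ i → i ≤ n → q i = x i) : x = reflectExtend τ n q := by
  funext i
  rw [← apply_emod_eq_of_periodic hx i, reflectExtend]
  have h0 := Int.emod_nonneg i (show (2 * n + 1 : ℤ) ≠ 0 by omega)
  have h1 := Int.emod_lt_of_pos i (show (0 : ℤ) < 2 * n + 1 by omega)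
  generalize i % (2 * n + 1) = r at h0 h1
  split_ifs with hr
  · rw [hq r h0 hr]
  · rw [hq _ (by omega) (by omega), ← hflip r, ← hx (-r)]
    congr 2
    ring

section FlipPair

variable {α : Type*} [Fintype α] [DecidableEq α] {A J : Matrix α α ℤ} {τ : α → α}

theorem IsFlipPair.apply_eq_ite (h : IsFlipPair A J) (hτ : ∀ a b, J a b = 1 ↔ τ a = b) (a b : α) :
    J a b = if τ a = b then 1 else 0 := by
  split_ifs with hab
  · exact (hτ a b).2 hab
  · exact (h.2.1 a b).resolve_right fun h1 => hab ((hτ a b).1 h1)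

theorem IsFlipPair.involutive (h : IsFlipPair A J) (hτ : ∀ a b, J a b = 1 ↔ τ a = b) :
    Function.Involutive τ := fun a => by
  have h1 := congrFun (congrFun h.2.2.2 a) a
  by_contra hne
  have h0 : (J * J) a a = 0 := Finset.sum_eq_zero fun b _ => by
    simp only [h.apply_eq_ite hτ]
    split_ifs with hab hba
    · exact absurd (hab ▸ hba) hne
    all_goals rfl
  simp [h0] at h1

theorem IsFlipPair.mul_apply_eq (h : IsFlipPair A J) (hτ : ∀ a b, J a b = 1 ↔ τ a = b) (a b : α) :
    (A * J) a b = A a (τ b) := by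
  have hinv := h.involutive hτ
  simp [Matrix.mul_apply, h.apply_eq_ite hτ, hinv.eq_iff]

theorem IsFlipPair.apply_flip (h : IsFlipPair A J) (hτ : ∀ a b, J a b = 1 ↔ τ a = b) (a b : α) :
    A (τ b) (τ a) = A a b := by
  have h1 := congrFun (congrFun h.2.2.1 (τ b)) a
  rw [h.mul_apply_eq hτ] at h1
  simpa [Matrix.mul_apply, h.apply_eq_ite hτ, h.involutive hτ b] using h1

end FlipPair

/-- **Theorem 3.3, first formula.** For a flip pair `(A, J)` and `m ≥ 1`:
`p_{2m-1,0}(σ_A, φ_{J,A}) = Δ_Jᵀ A^{m-1} Δ_{AJ}`. -/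
theorem stmt9 {𝒜 : Type*} [Fintype 𝒜] [DecidableEq 𝒜]
    (A J : Matrix 𝒜 𝒜 ℤ) (hAJ : IsFlipPair A J)
    (τ : 𝒜 → 𝒜) (hτ : ∀ a b, J a b = 1 ↔ τ a = b)
    (φJ : SFT A → SFT A) (hφJ : ∀ x i, (φJ x).1 i = τ (x.1 (-i)))
    (m : ℕ) (hm : 1 ≤ m) :
    (pFlip (shiftEquiv A) φJ (2 * m - 1) 0 : ℤ)
      = (fun a => J a a) ⬝ᵥ (A ^ (m - 1)).mulVec (fun a => (A * J) a a) := by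
  obtain ⟨n, rfl⟩ : ∃ n, m = n + 1 := ⟨m - 1, by omega⟩
  have hinv := hAJ.involutive hτ
  have hfix (x : SFT A) : (((shiftEquiv A ^ (2 * (n + 1) - 1)) x = x) ∧
      (shiftEquiv A ^ (0 : ℤ)) (φJ x) = x) ↔
      Function.Periodic x.1 (2 * n + 1) ∧ ∀ i, τ (x.1 (-i)) = x.1 i := by
    rw [show 2 * (n + 1) - 1 = 2 * n + 1 by omega, zpow_zero, Equiv.Perm.one_apply]
    simp only [Subtype.ext_iff, funext_iff, shiftEquiv_pow_apply, hφJ, Function.Periodic]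
    push_cast
    rfl
  rw [Nat.add_sub_cancel, dotProduct_pow_mulVec_eq_card_paths A _ _ hAJ.1 (fun a => hAJ.2.1 a a)
    (fun a => by rw [hAJ.mul_apply_eq hτ]; exact hAJ.1 _ _), pFlip]
  simp only [hfix, hτ, hAJ.mul_apply_eq hτ]
  congr 1
  let toPath (x : {x : SFT A //
      Function.Periodic x.1 (2 * n + 1) ∧ ∀ i, τ (x.1 (-i)) = x.1 i}) :
      {p : Fin (n + 1) → 𝒜 // τ (p 0) = p 0 ∧
        (∀ i : Fin n, A (p i.castSucc) (p i.succ) = 1) ∧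
        A (p (Fin.last n)) (τ (p (Fin.last n))) = 1} :=
    ⟨fun i => x.1.1 i, by simpa using x.2.2 0,
      fun i => by simpa using x.1.2 i, by
        have h1 := x.1.2 n
        have h2 := x.2.2 (n + 1)
        rw [← x.2.1 (-(n + 1)), show (-(n + 1) + (2 * n + 1) : ℤ) = n by ring] at h2
        simpa [h2] using h1⟩
  refine Nat.card_eq_of_bijective toPath ⟨fun x y hxy => ?_, fun p => ?_⟩
  · refine Subtype.ext (Subtype.ext ?_)
    rw [eq_reflectExtend x.2.1 x.2.2 (q := x.1.1) fun _ _ _ => rfl]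
    refine (eq_reflectExtend y.2.1 y.2.2 fun i h0 hi => ?_).symm
    lift i to ℕ using h0
    exact congrFun (congrArg Subtype.val hxy) ⟨i, by omega⟩
  · obtain ⟨p, hp0, hstep, hlast⟩ := p
    let q (i : ℤ) : 𝒜 := p ⟨min i.toNat n, by omega⟩
    have hq (i : Fin (n + 1)) : q i = p i := congrArg p (Fin.ext (by simp; omega))
    have hq0 : τ (q 0) = q 0 := by simpa [← hq] using hp0
    have hqstep (i : ℤ) (h0 : 0 ≤ i) (hi : i < n) : A (q i) (q (i + 1)) = 1 := by
      lift i to ℕ using h0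
      simpa [← hq] using hstep ⟨i, by omega⟩
    have hqlast : A (q n) (τ (q n)) = 1 := by simpa [← hq] using hlast
    refine ⟨⟨⟨reflectExtend τ n q,
      reflectExtend_mem_SFT (hAJ.apply_flip hτ) hq0 hqstep hqlast⟩,
      reflectExtend_periodic τ n q, reflectExtend_neg hinv n hq0⟩, Subtype.ext (funext fun i => ?_)⟩
    exact (reflectExtend_of_le τ n q (by omega) (by omega)).trans (hq i)
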